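/- arXiv:1809.05161 — 5 statements merged into one kernel-verified Lean document; each statement's English description precedes it below -/
import Mathlib

section
/- Let M ≥ 1 and N ≥ 1 be natural numbers, and let T > 0 and B ≥ 0 be real numbers with B ≤ M·N·T. Define natural numbers k(0), k(1), …, k(M−1) recursively by k(i) = min(N, ⌊(B − T·Σ_{j<i} k(j)) / T⌋), where ⌊·⌋ denotes the natural-number floor (equal to 0 for negative arguments). Then Σ_{i<M} k(i) = ⌊B/T⌋. -/
/-- The natural floor of the remaining budget, in units of `T`, after `s` units are spent. -/
theorem floor_sub_mul_div {T : ℝ} (hT : T ≠ 0) (B : ℝ) (s : ℕ) :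
    ⌊(B - T * s) / T⌋₊ = ⌊B / T⌋₊ - s := by
  rw [sub_div, mul_div_cancel_left₀ _ hT, Nat.floor_sub_natCast]

/-- Partial sums of a greedy allocation of `F` units with at most `N` units per step. -/
theorem sum_range_greedy {M N F : ℕ} {k : ℕ → ℕ}
    (hk : ∀ i < M, k i = min N (F - ∑ j ∈ Finset.range i, k j)) :
    ∀ m ≤ M, ∑ i ∈ Finset.range m, k i = min (m * N) F := by
  intro m
  induction m with
  | zero => simp
  | succ m ih =>
    intro hm
    rw [Finset.sum_range_succ, hk m hm, ih (Nat.le_of_succ_le hm), Nat.succ_mul]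
    omega

/-- Greedy allocation in the homogeneous setting (Eqs. (8a)–(8c) of Theorem 1):
with `B ≤ M·N·T`, if `k i = min N ⌊(B − T·Σ_{j<i} k j)/T⌋` for each `i < M`
(natural-number floor, equal to `0` on negative arguments), then the total number of
tasks `Σ_{i<M} k i` equals `⌊B/T⌋`. -/
theorem stmt5 (M N : ℕ) (hM : 1 ≤ M) (hN : 1 ≤ N) (T B : ℝ)
    (hT : 0 < T) (hB : 0 ≤ B) (hBMNT : B ≤ (M : ℝ) * N * T)
    (k : ℕ → ℕ)
    (hk : ∀ i < M, k i = min N ⌊(B - T * ∑ j ∈ Finset.range i, (k j : ℝ)) / T⌋₊) :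
    ∑ i ∈ Finset.range M, k i = ⌊B / T⌋₊ := by
  have hk' : ∀ i < M, k i = min N (⌊B / T⌋₊ - ∑ j ∈ Finset.range i, k j) := by
    intro i hi
    rw [hk i hi, ← Nat.cast_sum, floor_sub_mul_div hT.ne']
  rw [sum_range_greedy hk' M le_rfl, min_eq_right]
  apply Nat.floor_le_of_le
  rw [div_le_iff₀ hT]
  exact_mod_cast hBMNT
end

section
/- Let M ≥ 1 and N ≥ 1 be natural numbers, let T : Fin M → ℝ be monotone non-decreasing with T(m) > 0 for all m, and let B ≥ 0 be a real number. For every feasible allocation R : Fin M → Fin N → ℝ (i.e., R(m,n) ≥ 0 for all m, n and Σ_{m,n} R(m,n) ≤ B), the number of pairs (m,n) with R(m,n) ≥ T(m) is at most Σ_{i=0}^{M−1} min(N, ⌊max(B − N·Σ_{k<i} T(k), 0) / T(i)⌋), where ⌊·⌋ is the natural-number floor. -/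
open Finset in
/-- Counting form of greedy optimality: if the costs are non-decreasing and at most `N` copies of
each item may be bought, then no purchase within budget `B` buys more copies than the greedy one. -/
theorem sum_le_sum_greedy {M N : ℕ} {T : Fin M → ℝ} (hTmono : Monotone T) (hTpos : ∀ m, 0 < T m)
    {B : ℝ} {c : Fin M → ℕ} (hcN : ∀ i, c i ≤ N) (hcB : ∑ i, (c i : ℝ) * T i ≤ B) :
    ∑ i, c i ≤ ∑ i, min N ⌊max (B - (N : ℝ) * ∑ k ∈ Iio i, T k) 0 / T i⌋₊ := by
  set g : Fin M → ℕ := fun i => min N ⌊max (B - (N : ℝ) * ∑ k ∈ Iio i, T k) 0 / T i⌋₊ with hg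
  by_cases hfull : ∀ i, g i = N
  · exact sum_le_sum fun i _ => (hcN i).trans (hfull i).ge
  push Not at hfull
  obtain ⟨j, hj, hjmin⟩ : ∃ j, g j ≠ N ∧ ∀ i < j, g i = N := by
    obtain ⟨j, hj, hjmin⟩ := WellFounded.has_min (wellFounded_lt (α := Fin M)) {i | g i ≠ N} hfull
    exact ⟨j, hj, fun i hi => by_contra fun h => hjmin i h hi⟩
  -- The greedy purchase: everything before `j`, part of `j`, nothing afterwards.
  let h : Fin M → ℕ := fun i => if i < j then N else if i = j then g j else 0
  have h_le : ∑ i, h i ≤ ∑ i, g i := by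
    refine sum_le_sum fun i _ => ?_
    simp only [h]
    split_ifs with h₁ h₂
    · exact (hjmin i h₁).ge
    · rw [h₂]
    · exact Nat.zero_le _
  refine le_trans ?_ h_le
  by_contra! hlt
  have h_cost : ∑ i, (h i : ℝ) * T i = N * ∑ k ∈ Iio j, T k + g j * T j := by
    have h_term (i : Fin M) : (h i : ℝ) * T i =
        (if i < j then (N : ℝ) * T i else 0) + (if i = j then (g j : ℝ) * T j else 0) := by
      simp only [h]
      split_ifs with h₁ h₂ h₂
      · exact absurd h₂ h₁.ne
      · simp
      · simp [h₂]
      · simp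
    simp_rw [h_term, sum_add_distrib, mul_sum]
    rw [← sum_filter, sum_ite_eq' univ j]
    simp [filter_gt_eq_Iio]
  have h_budget : B < N * ∑ k ∈ Iio j, T k + g j * T j + T j := by
    have hfloor : g j = ⌊max (B - (N : ℝ) * ∑ k ∈ Iio j, T k) 0 / T j⌋₊ :=
      (min_choice _ _).resolve_left hj
    have hlt' := Nat.lt_floor_add_one (max (B - (N : ℝ) * ∑ k ∈ Iio j, T k) 0 / T j)
    rw [← hfloor, div_lt_iff₀ (hTpos j)] at hlt'
    linarith [le_max_left (B - (N : ℝ) * ∑ k ∈ Iio j, T k) 0]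
  have h_exchange : ∑ i, ((c i : ℝ) - h i) * T j ≤ ∑ i, ((c i : ℝ) - h i) * T i := by
    refine sum_le_sum fun i _ => ?_
    rcases lt_trichotomy i j with hi | rfl | hi
    · have : (c i : ℝ) ≤ N := mod_cast hcN i
      have hhi : h i = N := if_pos hi
      rw [hhi]
      exact mul_le_mul_of_nonpos_left (hTmono hi.le) (by linarith)
    · rfl
    · have hhi : h i = 0 := by simp [h, hi.not_gt, hi.ne']
      rw [hhi]
      exact mul_le_mul_of_nonneg_left (hTmono hi.le) (by simp)
  have h_gap : (∑ i, (h i : ℝ)) + 1 ≤ ∑ i, (c i : ℝ) := mod_cast hlt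
  rw [← sum_mul, sum_sub_distrib] at h_exchange
  simp_rw [sub_mul] at h_exchange
  rw [sum_sub_distrib, h_cost] at h_exchange
  nlinarith [mul_le_mul_of_nonneg_right h_gap (hTpos j).le]

/-- Heterogeneous-threshold upper bound (Theorem 3, formula for OPT*): with thresholds
`T` sorted in ascending order and positive, any feasible allocation `R` (nonnegative
rewards summing to at most `B`) accepts at most
`Σ_i min N ⌊max (B − N·Σ_{k<i} T k) 0 / T i⌋` tasks (natural-number floor). -/
theorem stmt6 (M N : ℕ) (hM : 1 ≤ M) (hN : 1 ≤ N)
    (T : Fin M → ℝ) (hTmono : Monotone T) (hTpos : ∀ m, 0 < T m)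
    (B : ℝ) (hB : 0 ≤ B)
    (R : Fin M → Fin N → ℝ)
    (hR0 : ∀ m n, 0 ≤ R m n)
    (hRB : ∑ m : Fin M, ∑ n : Fin N, R m n ≤ B) :
    {p : Fin M × Fin N | T p.1 ≤ R p.1 p.2}.ncard ≤
      ∑ i : Fin M, min N ⌊max (B - (N : ℝ) * ∑ k ∈ Finset.Iio i, T k) 0 / T i⌋₊ := by
  classical
  let c : Fin M → ℕ := fun i => (Finset.univ.filter fun n => T i ≤ R i n).card
  have h_count : {p : Fin M × Fin N | T p.1 ≤ R p.1 p.2}.ncard = ∑ i, c i := by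
    rw [Set.ncard_eq_toFinset_card']
    simp only [c, Set.toFinset_ofPred, Finset.card_filter, Fintype.sum_prod_type]
  rw [h_count]
  refine sum_le_sum_greedy hTmono hTpos (fun i => ?_) (le_trans ?_ hRB)
  · simpa using Finset.card_le_univ (Finset.univ.filter fun n => T i ≤ R i n)
  · refine Finset.sum_le_sum fun i _ => ?_
    calc (c i : ℝ) * T i ≤ ∑ n with T i ≤ R i n, R i n := by
          rw [← nsmul_eq_mul]
          exact Finset.card_nsmul_le_sum _ _ _ fun n hn => (Finset.mem_filter.1 hn).2
      _ ≤ ∑ n, R i n :=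
          Finset.sum_le_sum_of_subset_of_nonneg (Finset.filter_subset _ _) fun n _ _ => hR0 i n
end

section
/- Let M ≥ 1 and N ≥ 1 be natural numbers, let T : Fin M → ℝ be monotone non-decreasing with T(m) > 0 for all m, and let B ≥ 0 be a real number. Then there exists a feasible allocation R : Fin M → Fin N → ℝ (i.e., R(m,n) ≥ 0 for all m, n and Σ_{m,n} R(m,n) ≤ B) such that the number of pairs (m,n) with R(m,n) ≥ T(m) is exactly Σ_{i=0}^{M−1} min(N, ⌊max(B − N·Σ_{k<i} T(k), 0) / T(i)⌋), where ⌊·⌋ is the natural-number floor. -/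
/-- If each `x i` is at most `a i` and at most what is left of the budget `B` after all smaller
indices `k` have been charged `a k`, then the total of the `x i` stays within the budget. -/
theorem sum_le_of_le_remaining_budget {ι : Type*} [LinearOrder ι] [LocallyFiniteOrderBot ι]
    {a x : ι → ℝ} {B : ℝ} (hB : 0 ≤ B) (ha : ∀ i, 0 ≤ a i) (hxa : ∀ i, x i ≤ a i)
    (hx : ∀ i, x i ≤ max (B - ∑ k ∈ Finset.Iio i, a k) 0) (s : Finset ι) :
    ∑ i ∈ s, x i ≤ B := by
  induction s using Finset.induction_on_max with
  | empty => simpa using hB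
  | insert i s hs ih =>
    rw [Finset.sum_insert fun hi => (hs i hi).false]
    have hsum : ∑ k ∈ s, x k ≤ ∑ k ∈ Finset.Iio i, a k :=
      (Finset.sum_le_sum fun k _ => hxa k).trans <|
        Finset.sum_le_sum_of_subset_of_nonneg (fun k hk => Finset.mem_Iio.2 (hs k hk))
          fun k _ _ => ha k
    rcases le_max_iff.1 (hx i) with h | h <;> linarith

/-- The number of pairs `(i, n)` with `n < c i` is the sum of the `c i`, if these are at most `N`. -/
theorem ncard_setOf_val_lt {ι : Type*} [Fintype ι] {N : ℕ} (c : ι → ℕ) (hc : ∀ i, c i ≤ N) :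
    {p : ι × Fin N | (p.2 : ℕ) < c p.1}.ncard = ∑ i, c i := by
  classical
  rw [Set.ncard_eq_toFinset_card', Set.toFinset_ofPred, Finset.card_filter,
    Fintype.sum_prod_type]
  refine Finset.sum_congr rfl fun i _ => ?_
  simp only [← Finset.card_filter, Fin.card_filter_val_lt, min_eq_right (hc i)]

/-- Heterogeneous-threshold attainability (Theorem 3, formula for OPT*): with thresholds
`T` sorted in ascending order and positive, there is a feasible allocation `R`
(nonnegative rewards summing to at most `B`) that accepts exactly
`Σ_i min N ⌊max (B − N·Σ_{k<i} T k) 0 / T i⌋` tasks (natural-number floor). -/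
theorem stmt7 (M N : ℕ) (hM : 1 ≤ M) (hN : 1 ≤ N)
    (T : Fin M → ℝ) (hTmono : Monotone T) (hTpos : ∀ m, 0 < T m)
    (B : ℝ) (hB : 0 ≤ B) :
    ∃ R : Fin M → Fin N → ℝ,
      (∀ m n, 0 ≤ R m n) ∧
      (∑ m : Fin M, ∑ n : Fin N, R m n ≤ B) ∧
      {p : Fin M × Fin N | T p.1 ≤ R p.1 p.2}.ncard =
        ∑ i : Fin M, min N ⌊max (B - (N : ℝ) * ∑ k ∈ Finset.Iio i, T k) 0 / T i⌋₊ := by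
  set c : Fin M → ℕ := fun i =>
    min N ⌊max (B - (N : ℝ) * ∑ k ∈ Finset.Iio i, T k) 0 / T i⌋₊
  have hcN : ∀ i, c i ≤ N := fun i => min_le_left _ _
  refine ⟨fun m n => if (n : ℕ) < c m then T m else 0, fun m n => ?_, ?_, ?_⟩
  · dsimp only
    split_ifs
    exacts [(hTpos m).le, le_rfl]
  · have hrow : ∀ m, ∑ n : Fin N, (if (n : ℕ) < c m then T m else 0) = c m * T m := fun m => by
      rw [← Finset.sum_filter, Finset.sum_const, Fin.card_filter_val_lt, min_eq_right (hcN m),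
        nsmul_eq_mul]
    simp only [hrow]
    refine sum_le_of_le_remaining_budget (a := fun i => N * T i) hB
      (fun i => mul_nonneg N.cast_nonneg (hTpos i).le)
      (fun i => mul_le_mul_of_nonneg_right (Nat.cast_le.2 (hcN i)) (hTpos i).le)
      (fun i => ?_) _
    rw [← Finset.mul_sum, ← le_div_iff₀ (hTpos i)]
    exact (Nat.cast_le.2 (min_le_right _ _)).trans
      (Nat.floor_le (div_nonneg (le_max_right _ _) (hTpos i).le))
  · rw [← ncard_setOf_val_lt c hcN]
    congr 1
    ext p
    by_cases h : (p.2 : ℕ) < c p.1 <;> simp [h, hTpos p.1]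
end

section
/- Let M ≥ 2 and N ≥ 1 be natural numbers, let T : Fin M → ℝ be monotone non-decreasing with T(m) > 0 for all m, let i be an index with 1 ≤ i ≤ M−1 (so T(i) denotes the (i+1)-st smallest threshold in 0-based indexing), and let B be a real number with i·N·T(i) < B ≤ (i+1)·N·T(i). Then there exists a feasible allocation R : Fin M → Fin N → ℝ (i.e., R(m,n) ≥ 0 for all m, n and Σ_{m,n} R(m,n) ≤ B) such that the number of pairs (m,n) with R(m,n) ≥ T(m) is at least i·N + ⌊(B − i·N·T(i)) / T(i)⌋, where ⌊·⌋ is the natural-number floor. -/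
/-- Paying a flat price `t` on a set `S` of tasks whose thresholds are all at most `t` is a
feasible allocation for any budget covering `S.card * t`, and every task of `S` is accepted. -/
theorem exists_flat_allocation {M N : ℕ} {T : Fin M → ℝ} {t B : ℝ} (ht : 0 ≤ t)
    (S : Finset (Fin M × Fin N)) (hS : ∀ p ∈ S, T p.1 ≤ t) (hB : S.card * t ≤ B) :
    ∃ R : Fin M → Fin N → ℝ,
      (∀ m n, 0 ≤ R m n) ∧
      (∑ m : Fin M, ∑ n : Fin N, R m n ≤ B) ∧
      S.card ≤ {p : Fin M × Fin N | T p.1 ≤ R p.1 p.2}.ncard := by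
  refine ⟨fun m n => if (m, n) ∈ S then t else 0, fun m n => ?_, ?_, ?_⟩
  · dsimp only
    split_ifs <;> simp [ht]
  · rw [← Fintype.sum_prod_type' (fun m n => if (m, n) ∈ S then t else 0)]
    simpa using hB
  · rw [← Set.ncard_coe_finset S]
    refine Set.ncard_le_ncard (fun p hp => ?_) (Set.toFinite _)
    have hpS : p ∈ S := hp
    simpa [hpS] using hS p hpS

/-- Case 2 of Theorem 3: with ascending positive thresholds, an index `i` with
`1 ≤ i ≤ M−1` and budget `i·N·T(i) < B ≤ (i+1)·N·T(i)`, there is a feasible allocation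
accepting at least `i·N + ⌊(B − i·N·T(i))/T(i)⌋` tasks (natural-number floor). -/
theorem stmt8 (M N : ℕ) (hM : 2 ≤ M) (hN : 1 ≤ N)
    (T : Fin M → ℝ) (hTmono : Monotone T) (hTpos : ∀ m, 0 < T m)
    (i : ℕ) (hi1 : 1 ≤ i) (hiM : i ≤ M - 1)
    (B : ℝ)
    (hBlo : (i : ℝ) * N * T ⟨i, by omega⟩ < B)
    (hBhi : B ≤ ((i : ℝ) + 1) * N * T ⟨i, by omega⟩) :
    ∃ R : Fin M → Fin N → ℝ,
      (∀ m n, 0 ≤ R m n) ∧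
      (∑ m : Fin M, ∑ n : Fin N, R m n ≤ B) ∧
      i * N + ⌊(B - (i : ℝ) * N * T ⟨i, by omega⟩) / T ⟨i, by omega⟩⌋₊ ≤
        {p : Fin M × Fin N | T p.1 ≤ R p.1 p.2}.ncard := by
  have hi : i < M := by omega
  have ht := hTpos ⟨i, hi⟩
  have hmono : ∀ m : Fin M, m ≤ ⟨i, hi⟩ → T m ≤ T ⟨i, hi⟩ := fun m hm => hTmono hm
  generalize T ⟨i, hi⟩ = t at *
  have hfloor : (⌊(B - (i : ℝ) * N * t) / t⌋₊ : ℝ) * t ≤ B - (i : ℝ) * N * t :=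
    (le_div_iff₀ ht).1 (Nat.floor_le (div_nonneg (by linarith) ht.le))
  have hkN : ⌊(B - (i : ℝ) * N * t) / t⌋₊ ≤ N := by
    refine Nat.floor_le_of_le ((div_le_iff₀ ht).2 ?_)
    linarith
  obtain ⟨S, hS, hcard⟩ := Finset.exists_subset_card_eq
    (s := Finset.Iic (⟨i, hi⟩ : Fin M) ×ˢ (Finset.univ : Finset (Fin N)))
    (n := i * N + ⌊(B - (i : ℝ) * N * t) / t⌋₊)
    (by rw [Finset.card_product, Fin.card_Iic, Finset.card_univ, Fintype.card_fin]; lia)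
  rw [← hcard]
  refine exists_flat_allocation ht.le S (fun p hp => hmono p.1 ?_) ?_
  · simpa using hS hp
  · rw [hcard]
    push_cast
    linarith
end

section
/- Let M ≥ 1 and N ≥ 1 be natural numbers, let T : Fin M → ℝ be monotone non-decreasing with T(m) > 0 for all m, let i be a natural number with 1 ≤ i ≤ M (so T(i−1) denotes the i-th smallest threshold in 0-based indexing), and let B be a real number with i·N·T(i−1) ≤ B. Then there exists a feasible allocation R : Fin M → Fin N → ℝ (i.e., R(m,n) ≥ 0 for all m, n and Σ_{m,n} R(m,n) ≤ B) such that the number of pairs (m,n) with R(m,n) ≥ T(m) is at least i·N. -/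
/-- Case 3 of Theorem 3: with ascending positive thresholds, an index `i` with
`1 ≤ i ≤ M` and budget `B ≥ i·N·T(i−1)` (0-based indexing), there is a feasible
allocation accepting at least `i·N` tasks. -/
theorem stmt9 (M N : ℕ) (hM : 1 ≤ M) (hN : 1 ≤ N)
    (T : Fin M → ℝ) (hTmono : Monotone T) (hTpos : ∀ m, 0 < T m)
    (i : ℕ) (hi1 : 1 ≤ i) (hiM : i ≤ M)
    (B : ℝ) (hB : (i : ℝ) * N * T ⟨i - 1, by omega⟩ ≤ B) :
    ∃ R : Fin M → Fin N → ℝ,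
      (∀ m n, 0 ≤ R m n) ∧
      (∑ m : Fin M, ∑ n : Fin N, R m n ≤ B) ∧
      i * N ≤ {p : Fin M × Fin N | T p.1 ≤ R p.1 p.2}.ncard := by
  set S : Finset (Fin M) := Finset.univ.filter fun m => (m : ℕ) < i with hS
  have hcard : S.card = i := by
    rw [hS, Fin.card_filter_val_lt, min_eq_right hiM]
  refine ⟨fun m _ => if (m : ℕ) < i then T m else 0, fun m _ => ?_, ?_, ?_⟩
  · dsimp only
    split_ifs
    · exact (hTpos m).le
    · exact le_rfl
  · calc ∑ m : Fin M, ∑ _n : Fin N, (if (m : ℕ) < i then T m else 0)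
        = N * ∑ m ∈ S, T m := by
          simp [hS, Finset.sum_filter, Finset.mul_sum]
      _ ≤ N * (i * T ⟨i - 1, by omega⟩) := by
          gcongr
          have hsum : ∑ m ∈ S, T m ≤ S.card • T ⟨i - 1, by omega⟩ := by
            refine Finset.sum_le_card_nsmul S T _ fun m hm => hTmono ?_
            have hmi : (m : ℕ) < i := by simpa [hS] using hm
            exact Fin.le_def.mpr (Nat.le_sub_one_of_lt hmi)
          rwa [hcard, nsmul_eq_mul] at hsum
      _ ≤ B := by linarith
  · calc i * N = (↑(S ×ˢ (Finset.univ : Finset (Fin N))) : Set (Fin M × Fin N)).ncard := by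
          rw [Set.ncard_coe_finset, Finset.card_product, hcard, Finset.card_fin]
      _ ≤ _ := by
          refine Set.ncard_le_ncard (fun p hp => ?_) (Set.toFinite _)
          have hpi : (p.1 : ℕ) < i := by simpa [hS] using hp
          simp [hpi]
end
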